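/- Let δ ∈ (0,1] be a constant, and let I = (V,E,λ) and I' = (V,E',λ) be hardcore instances on the same vertex set with n = |V|, the same fugacity λ, and |E ⊕ E'| ≤ L. Let Δ = max{Δ_G, Δ_{G'}} where Δ_G, Δ_{G'} are the maximum degrees of G = (V,E) and G' = (V,E'). Assume Δ ≥ 3 and that one of the following holds: (i) λ ≤ (2−δ)/(Δ_G−2) and Ω_{I'} ⊆ Ω_I, or (ii) λ ≤ (2−δ)/(Δ_{G'}−2) and Ω_I ⊆ Ω_{I'}. Run the one-step local coupling for edge update between the Gibbs sampling chains on I and I' for T steps from X_0 = Y_0 = 0^V, with S = ∪_{{u,v}∈E⊕E'}{u,v}, D_t = {v : X_t(v) ≠ Y_t(v)}, and R_gra = Σ_{t=1}^T 1{v_t ∈ S ∪ Γ_G⁺(D_{t−1})}. Then there is an absolute constant c such that E[R_gra] ≤ c·Δ²·T·L/(δ·n), i.e., E[R_gra] = O(Δ²TL/(nδ)). -/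

import Mathlib

open Finset
open scoped ENNReal

/-- Exponential on `ℝ ∪ {−∞}` (modeled as `WithBot ℝ`), with `exp(−∞) = 0`. -/
noncomputable def expB (x : WithBot ℝ) : ℝ := WithBot.recBotCoe 0 Real.exp x

/-- Total variation distance between two distributions on a finite set. -/
noncomputable def tvDist {Q : Type*} [Fintype Q] (μ ν : Q → ℝ) : ℝ :=
  2⁻¹ * ∑ x, |μ x - ν x|

/-- `D` is a coupling of the distributions `μ` and `ν` on a finite set. -/
def IsCoupling {Q : Type*} [Fintype Q] (μ ν : Q → ℝ) (D : Q → Q → ℝ) : Prop :=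
  (∀ c c', 0 ≤ D c c') ∧ (∀ c, ∑ c', D c c' = μ c) ∧ (∀ c', ∑ c, D c c' = ν c')

/-- `D` is an optimal coupling of `μ` and `ν`: a coupling maximizing the probability
of agreement of the two coordinates. -/
def IsOptimalCoupling {Q : Type*} [Fintype Q] (μ ν : Q → ℝ) (D : Q → Q → ℝ) : Prop :=
  IsCoupling μ ν D ∧
    ∀ D' : Q → Q → ℝ, IsCoupling μ ν D' → ∑ c, D' c c ≤ ∑ c, D c c

/-- Distribution of a finite-state Markov chain with transition kernel `P` after `t` steps,
started from the initial distribution `init`. -/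
noncomputable def chainDist {S : Type*} [Fintype S] (P : S → S → ℝ) (init : S → ℝ) :
    ℕ → S → ℝ
  | 0 => init
  | t + 1 => fun s' => ∑ s, chainDist P init t s * P s s'

/-- Point mass at `s0`. -/
noncomputable def initDelta {S : Type*} [DecidableEq S] (s0 : S) : S → ℝ :=
  fun s => if s = s0 then 1 else 0

/-- Transition kernel of a coupled pair of single-site (Gibbs-sampling style) chains:
a uniformly random vertex `v` is picked, all other coordinates of both copies are copied,
and the pair of new values at `v` is drawn from the local coupling `Dloc v`. -/
noncomputable def pairKernel {V Q : Type*} [Fintype V] [Fintype Q]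
    (Dloc : V → (V → Q) → (V → Q) → Q → Q → ℝ)
    (p p' : (V → Q) × (V → Q)) : ℝ := by
  classical
  exact (Fintype.card V : ℝ)⁻¹ * ∑ v,
    (if (∀ u, u ≠ v → p'.1 u = p.1 u) ∧ (∀ u, u ≠ v → p'.2 u = p.2 u)
      then Dloc v p.1 p.2 (p'.1 v) (p'.2 v) else 0)

/-- The resampling probability `p(c)` used in the local coupling for Hamiltonian update. -/
noncomputable def pResample {Q : Type*} (μ μ' : Q → ℝ) (c : Q) : ℝ := by
  classical
  exact if μ c ≤ μ' c then 0 else (μ c - μ' c) / μ c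

/-- The resampling distribution `ν` used in the local coupling for Hamiltonian update. -/
noncomputable def nuResample {Q : Type*} [Fintype Q] (μ μ' : Q → ℝ) (b : Q) : ℝ :=
  max 0 (μ' b - μ b) / ∑ x, max 0 (μ x - μ' x)

/-- The joint law of the local coupling for Hamiltonian update: first `(c,c')` is drawn from
the optimal coupling `Dopt`, then with probability `pResample μ μ' c'` the second coordinate
is resampled from `nuResample μ μ'`. -/
noncomputable def hamCoupling {Q : Type*} [Fintype Q] (μ μ' : Q → ℝ)
    (Dopt : Q → Q → ℝ) (c d : Q) : ℝ :=
  Dopt c d * (1 - pResample μ μ' d) +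
    nuResample μ μ' d * ∑ c', Dopt c c' * pResample μ μ' c'

/-- Indicator (as a real number) of the event `v ∈ Γ⁺(D)`, where `D` is the set of
disagreements between the two coordinates of the pair state `p`. -/
noncomputable def indNbr {V Q : Type*} [Fintype V] (G : SimpleGraph V)
    (p : (V → Q) × (V → Q)) (v : V) : ℝ := by
  classical
  exact if (∃ u, (u = v ∨ G.Adj v u) ∧ p.1 u ≠ p.2 u) then 1 else 0

/-- `v` is incident to an edge of the symmetric difference of the edge sets of `G` and `G'`. -/
def inS {V : Type*} (G G' : SimpleGraph V) (v : V) : Prop :=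
  ∃ u, (G.Adj v u ∧ ¬ G'.Adj v u) ∨ (G'.Adj v u ∧ ¬ G.Adj v u)

/-- Indicator (as a real number) of the event `v ∈ S ∪ Γ_G⁺(D)`. -/
noncomputable def indSnbr {V Q : Type*} [Fintype V] (G G' : SimpleGraph V)
    (p : (V → Q) × (V → Q)) (v : V) : ℝ := by
  classical
  exact if inS G G' v ∨ (∃ u, (u = v ∨ G.Adj v u) ∧ p.1 u ≠ p.2 u) then 1 else 0

/-- A configuration `σ : V → Bool` is feasible for the hardcore model on `G`
(its support is an independent set). -/
def IsIndep {V : Type*} (G : SimpleGraph V) (σ : V → Bool) : Prop :=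
  ∀ u v, G.Adj u v → ¬(σ u = true ∧ σ v = true)

/-- Conditional marginal distribution at `v` of the hardcore model on `G` with fugacity `lam`,
given the configuration `τ` on the neighborhood of `v`. -/
noncomputable def margHC {V : Type*} [Fintype V] (G : SimpleGraph V) [DecidableRel G.Adj]
    (lam : ℝ) (v : V) (τ : V → Bool) (b : Bool) : ℝ := by
  classical
  exact (if b then (if ∀ u ∈ G.neighborFinset v, τ u = false then lam else 0) else 1) /
    (1 + (if ∀ u ∈ G.neighborFinset v, τ u = false then lam else 0))

/-- Unnormalized hardcore weight `λ^{‖σ‖}` of a feasible configuration (and `0` otherwise). -/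
noncomputable def hcWeight {V : Type*} [Fintype V] (G : SimpleGraph V)
    (lam : ℝ) (σ : V → Bool) : ℝ := by
  classical
  exact if IsIndep G σ then lam ^ (Finset.univ.filter fun v => σ v = true).card else 0

/-- The hardcore Gibbs distribution `μ_I(σ) ∝ λ^{‖σ‖}` on independent-set configurations. -/
noncomputable def hcGibbs {V : Type*} [Fintype V] [DecidableEq V] (G : SimpleGraph V)
    (lam : ℝ) (σ : V → Bool) : ℝ :=
  hcWeight G lam σ / ∑ σ' : V → Bool, hcWeight G lam σ'

/-- Transition kernel of the Gibbs sampling chain of the hardcore model. -/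
noncomputable def gibbsStepHC {V : Type*} [Fintype V] (G : SimpleGraph V) [DecidableRel G.Adj]
    (lam : ℝ) (σ σ' : V → Bool) : ℝ := by
  classical
  exact (Fintype.card V : ℝ)⁻¹ *
    ∑ v, (if ∀ u, u ≠ v → σ' u = σ u then margHC G lam v σ (σ' v) else 0)

/-- The indicator of a proposition as a real number. -/
noncomputable def ind (P : Prop) : ℝ := by
  classical
  exact if P then 1 else 0

lemma ind_of_true {P : Prop} (h : P) : ind P = 1 := by simp [ind, h]

lemma ind_of_false {P : Prop} (h : ¬ P) : ind P = 0 := by simp [ind, h]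

lemma ind_nonneg (P : Prop) : 0 ≤ ind P := by
  unfold ind; split_ifs <;> norm_num

lemma ind_le_one (P : Prop) : ind P ≤ 1 := by
  unfold ind; split_ifs <;> norm_num

lemma ind_mono {P Q : Prop} (h : P → Q) : ind P ≤ ind Q := by
  by_cases hP : P
  · rw [ind_of_true hP, ind_of_true (h hP)]
  · rw [ind_of_false hP]; exact ind_nonneg Q

lemma sum_ind_eq_card {V : Type*} [Fintype V] (P : V → Prop) [DecidablePred P] :
    ∑ v, ind (P v) = ((univ.filter P).card : ℝ) := by
  rw [Finset.card_filter]
  push_cast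
  refine Finset.sum_congr rfl fun v _ => ?_
  unfold ind
  split_ifs <;> rfl

/-- Deleting a single element from two finite sets: the expected change of the event that exactly
one of them is nonempty. -/
lemma two_mul_ind_add_sum_erase_le {V : Type*} [Fintype V] [DecidableEq V] (A B : Finset V) :
    2 * ind (¬ (A.Nonempty ↔ B.Nonempty)) +
      ∑ v, (ind (¬ ((A.erase v).Nonempty ↔ (B.erase v).Nonempty)) -
        ind (¬ (A.Nonempty ↔ B.Nonempty))) ≤ ((symmDiff A B).card : ℝ) := by
  have one_sided : ∀ A : Finset V, A.Nonempty →
      2 * 1 + ∑ v, (ind (A.erase v).Nonempty - 1) ≤ (A.card : ℝ) := by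
    intro A hA
    by_cases h1 : A.card = 1
    · obtain ⟨a, rfl⟩ := Finset.card_eq_one.mp h1
      have : ∑ v, (ind (({a} : Finset V).erase v).Nonempty - 1) ≤ -1 := by
        rw [← Finset.add_sum_erase _ _ (Finset.mem_univ a)]
        have h2 : ind (({a} : Finset V).erase a).Nonempty = 0 := ind_of_false (by simp)
        have h3 : ∑ v ∈ univ.erase a, (ind (({a} : Finset V).erase v).Nonempty - 1) ≤ 0 :=
          Finset.sum_nonpos fun v _ => by linarith [ind_le_one (({a} : Finset V).erase v).Nonempty]
        linarith
      simp only [Finset.card_singleton, Nat.cast_one]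
      linarith
    · have h2 : 2 ≤ A.card := by have := hA.card_pos; omega
      have h3 : ∑ v, (ind (A.erase v).Nonempty - 1) ≤ 0 :=
        Finset.sum_nonpos fun v _ => by linarith [ind_le_one (A.erase v).Nonempty]
      have : (2 : ℝ) ≤ A.card := by exact_mod_cast h2
      linarith
  by_cases hA : A.Nonempty <;> by_cases hB : B.Nonempty
  · have h0 : ind (¬ (A.Nonempty ↔ B.Nonempty)) = 0 := ind_of_false (by simp [hA, hB])
    rw [h0]
    simp only [mul_zero, sub_zero, zero_add]
    by_cases hAB : A = B
    · subst hAB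
      simp [ind]
    have hpos : (1 : ℝ) ≤ ((symmDiff A B).card : ℝ) := by
      have : 0 < (symmDiff A B).card := by
        rw [Finset.card_pos, Finset.nonempty_iff_ne_empty]
        intro h
        exact hAB (symmDiff_eq_bot.mp h)
      exact_mod_cast this
    by_cases hC : (A ∩ B).Nonempty
    · obtain ⟨c, hc⟩ := hC
      rw [Finset.mem_inter] at hc
      rw [← Finset.add_sum_erase _ _ (Finset.mem_univ c)]
      have h3 : ∑ v ∈ univ.erase c, ind (¬ ((A.erase v).Nonempty ↔ (B.erase v).Nonempty)) = 0 := by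
        refine Finset.sum_eq_zero fun v hv => ind_of_false ?_
        have hcv : c ≠ v := (Finset.ne_of_mem_erase hv).symm
        have h4 : (A.erase v).Nonempty := ⟨c, Finset.mem_erase.mpr ⟨hcv, hc.1⟩⟩
        have h5 : (B.erase v).Nonempty := ⟨c, Finset.mem_erase.mpr ⟨hcv, hc.2⟩⟩
        simp [h4, h5]
      rw [h3]
      linarith [ind_le_one (¬ ((A.erase c).Nonempty ↔ (B.erase c).Nonempty))]
    · have h6 : ((symmDiff A B).card : ℝ) = ∑ v, ind (v ∈ symmDiff A B) := by
        rw [sum_ind_eq_card]; simp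
      rw [h6]
      refine Finset.sum_le_sum fun v _ => ind_mono fun h => ?_
      have hvC : ¬ (v ∈ A ∧ v ∈ B) := fun h => hC ⟨v, Finset.mem_inter.mpr h⟩
      rw [Finset.mem_symmDiff]
      by_contra hcon
      apply h
      have hvA : v ∉ A := by tauto
      have hvB : v ∉ B := by tauto
      rw [Finset.erase_eq_of_notMem hvA, Finset.erase_eq_of_notMem hvB]
      simp [hA, hB]
  · rw [Finset.not_nonempty_iff_eq_empty] at hB
    subst hB
    have h := one_sided A hA
    have hs : symmDiff A ∅ = A := symmDiff_bot A
    simpa [hA, hs, ind_of_true, -Finset.not_nonempty_iff_eq_empty] using h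
  · rw [Finset.not_nonempty_iff_eq_empty] at hA
    subst hA
    have h := one_sided B hB
    have hs : symmDiff ∅ B = B := bot_symmDiff B
    simpa [hB, hs, ind_of_true, -Finset.not_nonempty_iff_eq_empty] using h
  · rw [Finset.not_nonempty_iff_eq_empty] at hA hB
    subst hA hB
    simp [ind]

/-- `v` has an occupied neighbour in `σ`. -/
def Blocked {V : Type*} (H : SimpleGraph V) (σ : V → Bool) (v : V) : Prop :=
  ∃ w, H.Adj v w ∧ σ w = true

lemma Blocked.mono {V : Type*} {H K : SimpleGraph V} (h : H ≤ K) {σ : V → Bool} {v : V}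
    (hb : Blocked H σ v) : Blocked K σ v :=
  hb.imp fun _ hw => ⟨h hw.1, hw.2⟩

lemma blocked_update_of_not_adj {V : Type*} [DecidableEq V] {H : SimpleGraph V} {u v : V}
    (h : ¬ H.Adj u v) (σ : V → Bool) (b : Bool) :
    Blocked H (Function.update σ v b) u ↔ Blocked H σ u := by
  refine exists_congr fun w => and_congr_right fun hw => ?_
  have : w ≠ v := fun e => h (e ▸ hw)
  rw [Function.update_of_ne this]

lemma blocked_update_of_adj {V : Type*} [DecidableEq V] {H : SimpleGraph V} {u v : V}
    (h : H.Adj u v) (σ : V → Bool) (b : Bool) :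
    Blocked H (Function.update σ v b) u ↔
      b = true ∨ Blocked H (Function.update σ v false) u := by
  constructor
  · rintro ⟨w, hw, hb⟩
    by_cases e : w = v
    · subst e
      left
      simpa using hb
    · right
      exact ⟨w, hw, by simpa [e] using hb⟩
  · rintro (hb | ⟨w, hw, hb⟩)
    · exact ⟨v, h, by simpa using hb⟩
    · have e : w ≠ v := by
        rintro rfl
        simp at hb
      exact ⟨w, hw, by simpa [e] using hb⟩

lemma blocked_iff_of_adj {V : Type*} [DecidableEq V] {H : SimpleGraph V} {u v : V}
    (h : H.Adj u v) (σ : V → Bool) :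
    Blocked H σ u ↔ σ v = true ∨ Blocked H (Function.update σ v false) u := by
  have := blocked_update_of_adj h σ (σ v)
  rwa [Function.update_eq_self] at this

lemma IsIndep.not_blocked {V : Type*} {H : SimpleGraph V} {σ : V → Bool} (h : IsIndep H σ)
    {v : V} (hv : σ v = true) : ¬ Blocked H σ v :=
  fun ⟨w, hw, hb⟩ => h v w hw ⟨hv, hb⟩

lemma IsIndep.update {V : Type*} [DecidableEq V] {H : SimpleGraph V} {σ : V → Bool}
    (h : IsIndep H σ) {v : V} {b : Bool} (hb : b = true → ¬ Blocked H σ v) :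
    IsIndep H (Function.update σ v b) := by
  rintro x y hxy ⟨hx, hy⟩
  by_cases ex : x = v
  · subst ex
    have ey : y ≠ x := hxy.ne'
    rw [Function.update_self] at hx
    rw [Function.update_of_ne ey] at hy
    exact hb hx ⟨y, hxy, hy⟩
  · rw [Function.update_of_ne ex] at hx
    by_cases ey : y = v
    · subst ey
      rw [Function.update_self] at hy
      exact hb hy ⟨x, hxy.symm, hx⟩
    · rw [Function.update_of_ne ey] at hy
      exact h x y hxy ⟨hx, hy⟩

/-- Indicator that `u` is blocked in exactly one of `σ`, `τ`. -/
noncomputable def indHalf {V : Type*} (H : SimpleGraph V) (σ τ : V → Bool) (u : V) : ℝ :=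
  ind (¬ (Blocked H σ u ↔ Blocked H τ u))

lemma two_mul_indHalf_add_sum_le {V : Type*} [Fintype V] [DecidableEq V] (H : SimpleGraph V)
    (σ τ : V → Bool) (u : V) :
    2 * indHalf H σ τ u +
      ∑ v, (indHalf H (Function.update σ v false) (Function.update τ v false) u -
        indHalf H σ τ u) ≤ ∑ v, ind (H.Adj u v) * ind (σ v ≠ τ v) := by
  classical
  let N : (V → Bool) → Finset V := fun σ => univ.filter fun w => H.Adj u w ∧ σ w = true
  have h1 : ∀ σ : V → Bool, Blocked H σ u ↔ (N σ).Nonempty := by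
    intro σ
    simp [N, Blocked, Finset.Nonempty]
  have h2 : ∀ (σ : V → Bool) v, N (Function.update σ v false) = (N σ).erase v := by
    intro σ v
    ext w
    by_cases e : w = v <;> simp [N, e]
  have key := two_mul_ind_add_sum_erase_le (N σ) (N τ)
  simp only [indHalf, h1, h2]
  refine key.trans (le_of_eq ?_)
  have h3 : ((symmDiff (N σ) (N τ)).card : ℝ) = ∑ v, ind (v ∈ symmDiff (N σ) (N τ)) := by
    rw [sum_ind_eq_card]; simp
  rw [h3]
  refine Finset.sum_congr rfl fun v _ => ?_
  by_cases e : H.Adj u v <;> cases hσ : σ v <;> cases hτ : τ v <;>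
    simp [N, Finset.mem_symmDiff, ind, e, hσ, hτ]

/-- The optimal coupling of two single-site hardcore marginals with occupation probability `p`
for unblocked vertices; `P` and `Q` say whether the vertex is blocked in the two copies. -/
noncomputable def idealCoupling (p : ℝ) (P Q : Prop) (b b' : Bool) : ℝ :=
  match b, b' with
  | true, true => p * ind (¬ P ∧ ¬ Q)
  | true, false => p * ind (¬ P ∧ Q)
  | false, true => p * ind (P ∧ ¬ Q)
  | false, false => 1 - p * ind (¬ (P ∧ Q))

lemma sum_idealCoupling (p : ℝ) (P Q : Prop) : ∑ b, ∑ b', idealCoupling p P Q b b' = 1 := by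
  by_cases hP : P <;> by_cases hQ : Q <;> simp [idealCoupling, ind, hP, hQ]

lemma idealCoupling_nonneg {p : ℝ} (h0 : 0 ≤ p) (h1 : p ≤ 1) (P Q : Prop) (b b' : Bool) :
    0 ≤ idealCoupling p P Q b b' := by
  by_cases hP : P <;> by_cases hQ : Q <;> cases b <;> cases b' <;>
    simp [idealCoupling, ind, hP, hQ, h0, h1]

lemma idealCoupling_change_le {p : ℝ} (h0 : 0 ≤ p) (P Q A B : Prop) (x y : Bool)
    (hx : x = true → ¬ P) (hy : y = true → ¬ Q) :
    ∑ b, ∑ b', idealCoupling p P Q b b' *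
      (ind (¬ ((b = true ∨ A) ↔ (b' = true ∨ B))) - ind (¬ ((x = true ∨ A) ↔ (y = true ∨ B)))) ≤
    p * (ind (¬ (x = true ∨ A) ∧ ¬ (y = true ∨ B)) * ind (¬ (P ↔ Q)) -
      ind (¬ ((x = true ∨ A) ↔ (y = true ∨ B))) * ind (¬ P ∧ ¬ Q)) +
    (1 - p) * (ind (¬ (A ↔ B)) - ind (¬ ((x = true ∨ A) ↔ (y = true ∨ B)))) := by
  by_cases hP : P <;> by_cases hQ : Q <;> by_cases hA : A <;> by_cases hB : B <;>
    cases x <;> cases y <;> simp_all [idealCoupling, ind]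

/-- Expected change of a function of the pair of copies under an ideal update of `v`. -/
noncomputable def idealChange {V : Type*} [DecidableEq V] (H : SimpleGraph V) (p : ℝ)
    (F : (V → Bool) → (V → Bool) → ℝ) (σ τ : V → Bool) (v : V) : ℝ :=
  ∑ b, ∑ b', idealCoupling p (Blocked H σ v) (Blocked H τ v) b b' *
    (F (Function.update σ v b) (Function.update τ v b') - F σ τ)

/-- Indicator that `u` is unblocked in both copies. -/
noncomputable def indFree {V : Type*} (H : SimpleGraph V) (σ τ : V → Bool) (u : V) : ℝ :=
  ind (¬ Blocked H σ u ∧ ¬ Blocked H τ u)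

lemma idealChange_indHalf_le {V : Type*} [DecidableEq V] (H : SimpleGraph V) {p : ℝ}
    (h0 : 0 ≤ p) {σ τ : V → Bool} (hσ : IsIndep H σ) (hτ : IsIndep H τ) (u v : V) :
    idealChange H p (fun σ τ => indHalf H σ τ u) σ τ v ≤
      p * (ind (H.Adj u v) * (indFree H σ τ u * indHalf H σ τ v -
        indHalf H σ τ u * indFree H σ τ v)) +
      (1 - p) * (indHalf H (Function.update σ v false) (Function.update τ v false) u -
        indHalf H σ τ u) := by
  by_cases h : H.Adj u v
  · have key := idealCoupling_change_le h0 (Blocked H σ v) (Blocked H τ v)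
      (Blocked H (Function.update σ v false) u) (Blocked H (Function.update τ v false) u)
      (σ v) (τ v) hσ.not_blocked hτ.not_blocked
    rw [← blocked_iff_of_adj h, ← blocked_iff_of_adj h] at key
    simp only [← blocked_update_of_adj h] at key
    rw [ind_of_true h, one_mul]
    exact key
  · simp [idealChange, indHalf, blocked_update_of_not_adj h, ind_of_false h]

/-- The potential `|D| + β |B|`, where `D` is the disagreement set and `B` the set of vertices
blocked in exactly one of the copies. -/
noncomputable def potential {V : Type*} [Fintype V] (H : SimpleGraph V) (β : ℝ)
    (σ τ : V → Bool) : ℝ :=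
  ∑ v, ind (σ v ≠ τ v) + β * ∑ u, indHalf H σ τ u

/-- The number of disagreements. -/
noncomputable def disagree {V : Type*} [Fintype V] (σ τ : V → Bool) : ℝ :=
  ∑ v, ind (σ v ≠ τ v)

lemma disagree_nonneg {V : Type*} [Fintype V] (σ τ : V → Bool) : 0 ≤ disagree σ τ :=
  Finset.sum_nonneg fun _ _ => ind_nonneg _

lemma potential_nonneg {V : Type*} [Fintype V] (H : SimpleGraph V) {β : ℝ} (hβ : 0 ≤ β)
    (σ τ : V → Bool) : 0 ≤ potential H β σ τ :=
  add_nonneg (Finset.sum_nonneg fun _ _ => ind_nonneg _)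
    (mul_nonneg hβ (Finset.sum_nonneg fun _ _ => ind_nonneg _))

lemma potential_self {V : Type*} [Fintype V] (H : SimpleGraph V) (β : ℝ) (σ : V → Bool) :
    potential H β σ σ = 0 := by
  simp [potential, indHalf, ind]

lemma sum_disagree_update {V : Type*} [Fintype V] [DecidableEq V] (σ τ : V → Bool) (v : V)
    (b b' : Bool) :
    ∑ u, ind (Function.update σ v b u ≠ Function.update τ v b' u) - ∑ u, ind (σ u ≠ τ u) =
      ind (b ≠ b') - ind (σ v ≠ τ v) := by
  rw [← Finset.sum_sub_distrib, Finset.sum_eq_single v]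
  · simp
  · intro u _ hu
    simp [hu]
  · simp

lemma potential_update_sub {V : Type*} [Fintype V] [DecidableEq V] (H : SimpleGraph V) (β : ℝ)
    (σ τ : V → Bool) (v : V) (b b' : Bool) :
    potential H β (Function.update σ v b) (Function.update τ v b') - potential H β σ τ =
      (ind (b ≠ b') - ind (σ v ≠ τ v)) +
      β * ∑ u, (indHalf H (Function.update σ v b) (Function.update τ v b') u -
        indHalf H σ τ u) := by
  rw [← sum_disagree_update, Finset.sum_sub_distrib]
  unfold potential
  ring

lemma sum_ind_adj_le {V : Type*} [Fintype V] (H : SimpleGraph V) [DecidableRel H.Adj] (v : V) :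
    ∑ u, ind (H.Adj u v) ≤ (H.maxDegree : ℝ) := by
  rw [sum_ind_eq_card]
  have h : (univ.filter fun u => H.Adj u v) = H.neighborFinset v := by
    ext u
    simp [H.adj_comm]
  rw [h, H.card_neighborFinset_eq_degree]
  exact_mod_cast H.degree_le_maxDegree v

lemma abs_potential_update_sub_le {V : Type*} [Fintype V] [DecidableEq V] (H : SimpleGraph V)
    [DecidableRel H.Adj] {β : ℝ} (hβ : 0 ≤ β) (σ τ : V → Bool) (v : V) (b b' : Bool) :
    |potential H β (Function.update σ v b) (Function.update τ v b') - potential H β σ τ| ≤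
      1 + β * H.maxDegree := by
  rw [potential_update_sub]
  have hsub : ∀ P Q : Prop, |ind P - ind Q| ≤ 1 := fun P Q => by
    rw [abs_le]
    constructor <;> linarith [ind_nonneg P, ind_nonneg Q, ind_le_one P, ind_le_one Q]
  refine (abs_add_le _ _).trans (add_le_add (hsub _ _) ?_)
  rw [abs_mul, abs_of_nonneg hβ]
  refine mul_le_mul_of_nonneg_left ?_ hβ
  refine (Finset.abs_sum_le_sum_abs _ _).trans (le_trans ?_ (sum_ind_adj_le H v))
  refine Finset.sum_le_sum fun u _ => ?_
  by_cases h : H.Adj u v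
  · rw [ind_of_true h]
    exact hsub _ _
  · simp [indHalf, blocked_update_of_not_adj h, ind_nonneg]

lemma idealChange_potential {V : Type*} [Fintype V] [DecidableEq V] (H : SimpleGraph V)
    (p β : ℝ) (σ τ : V → Bool) (v : V) :
    idealChange H p (potential H β) σ τ v =
      p * indHalf H σ τ v - ind (σ v ≠ τ v) +
      β * ∑ u, idealChange H p (fun σ τ => indHalf H σ τ u) σ τ v := by
  have h1 : idealChange H p (potential H β) σ τ v =
      ∑ b, ∑ b', (idealCoupling p (Blocked H σ v) (Blocked H τ v) b b' * ind (b ≠ b') -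
        idealCoupling p (Blocked H σ v) (Blocked H τ v) b b' * ind (σ v ≠ τ v)) +
      ∑ b, ∑ b', β * ∑ u, idealCoupling p (Blocked H σ v) (Blocked H τ v) b b' *
        (indHalf H (Function.update σ v b) (Function.update τ v b') u - indHalf H σ τ u) := by
    unfold idealChange
    simp only [← Finset.sum_add_distrib]
    refine Finset.sum_congr rfl fun b _ => Finset.sum_congr rfl fun b' _ => ?_
    rw [potential_update_sub, ← Finset.mul_sum]
    ring
  rw [h1]
  congr 1
  · simp only [Finset.sum_sub_distrib, ← Finset.sum_mul, sum_idealCoupling, one_mul]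
    congr 1
    by_cases hP : Blocked H σ v <;> by_cases hQ : Blocked H τ v <;>
      simp [idealCoupling, ind, indHalf, hP, hQ]
  · unfold idealChange
    rw [Finset.sum_comm, Finset.mul_sum]
    simp only [Fintype.sum_bool, Finset.mul_sum, ← Finset.sum_add_distrib]
    refine Finset.sum_congr rfl fun u _ => ?_
    ring

/-- Contraction of the potential under ideal updates in the regime `λ (Δ - 2) < 2`. -/
lemma sum_idealChange_potential_le {V : Type*} [Fintype V] [DecidableEq V] (H : SimpleGraph V)
    [DecidableRel H.Adj] {p β : ℝ} (h0 : 0 ≤ p) (hβ : 0 ≤ β)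
    (hpβ : β * (1 - p) = p / 2) {σ τ : V → Bool} (hσ : IsIndep H σ) (hτ : IsIndep H τ) :
    ∑ v, idealChange H p (potential H β) σ τ v ≤
      -(1 - p / 2 * H.maxDegree) * disagree σ τ := by
  have hcancel : ∑ v, ∑ u, (ind (H.Adj u v) * (indFree H σ τ u * indHalf H σ τ v -
        indHalf H σ τ u * indFree H σ τ v)) = 0 := by
    simp only [mul_sub, Finset.sum_sub_distrib]
    rw [sub_eq_zero, Finset.sum_comm]
    refine Finset.sum_congr rfl fun v _ => Finset.sum_congr rfl fun u _ => ?_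
    rw [H.adj_comm]
    ring
  have hhalf : ∑ v, ∑ u, idealChange H p (fun σ τ => indHalf H σ τ u) σ τ v ≤
      (1 - p) * ∑ u, ∑ v, (indHalf H (Function.update σ v false) (Function.update τ v false) u -
        indHalf H σ τ u) := by
    calc _ ≤ ∑ v, ∑ u, (p * (ind (H.Adj u v) * (indFree H σ τ u * indHalf H σ τ v -
        indHalf H σ τ u * indFree H σ τ v)) +
        (1 - p) * (indHalf H (Function.update σ v false) (Function.update τ v false) u -
        indHalf H σ τ u)) := Finset.sum_le_sum fun v _ => Finset.sum_le_sum fun u _ =>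
          idealChange_indHalf_le H h0 hσ hτ u v
      _ = _ := by
        simp only [Finset.sum_add_distrib, ← Finset.mul_sum, hcancel]
        rw [mul_zero, zero_add, Finset.sum_comm]
  have hdeg : ∑ u, ∑ v, ind (H.Adj u v) * ind (σ v ≠ τ v) ≤ H.maxDegree * disagree σ τ := by
    rw [Finset.sum_comm]
    unfold disagree
    rw [Finset.mul_sum]
    refine Finset.sum_le_sum fun v _ => ?_
    rw [← Finset.sum_mul]
    exact mul_le_mul_of_nonneg_right (sum_ind_adj_le H v) (ind_nonneg _)
  have hloc : ∑ u, (2 * indHalf H σ τ u +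
      ∑ v, (indHalf H (Function.update σ v false) (Function.update τ v false) u -
        indHalf H σ τ u)) ≤ ∑ u, ∑ v, ind (H.Adj u v) * ind (σ v ≠ τ v) :=
    Finset.sum_le_sum fun u _ => two_mul_indHalf_add_sum_le H σ τ u
  rw [Finset.sum_add_distrib, ← Finset.mul_sum] at hloc
  simp only [idealChange_potential, Finset.sum_add_distrib, Finset.sum_sub_distrib,
    ← Finset.mul_sum]
  have h3 := mul_le_mul_of_nonneg_left hhalf hβ
  rw [← mul_assoc, hpβ] at h3
  have h4 := mul_le_mul_of_nonneg_left (hloc.trans hdeg) (by linarith : (0 : ℝ) ≤ p / 2)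
  unfold disagree at *
  linarith

/-- The difference between an arbitrary coupled update on the vertices of `S` and the ideal update
costs at most a constant per vertex of `S`. -/
lemma sum_change_potential_le {V : Type*} [Fintype V] [DecidableEq V] (H : SimpleGraph V)
    [DecidableRel H.Adj] {p β : ℝ} (h0 : 0 ≤ p) (h1 : p ≤ 1) (hβ : 0 ≤ β)
    (hpβ : β * (1 - p) = p / 2) (S : V → Prop)
    (D : V → (V → Bool) → (V → Bool) → Bool → Bool → ℝ)
    (hD0 : ∀ v σ τ b b', 0 ≤ D v σ τ b b') (hD1 : ∀ v σ τ, ∑ b, ∑ b', D v σ τ b b' = 1)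
    (hD : ∀ v σ τ, ¬ S v → D v σ τ = idealCoupling p (Blocked H σ v) (Blocked H τ v))
    {σ τ : V → Bool} (hσ : IsIndep H σ) (hτ : IsIndep H τ) :
    ∑ v, ∑ b, ∑ b', D v σ τ b b' *
        (potential H β (Function.update σ v b) (Function.update τ v b') - potential H β σ τ) ≤
      -(1 - p / 2 * H.maxDegree) * disagree σ τ +
        2 * (1 + β * H.maxDegree) * ∑ v, ind (S v) := by
  refine le_trans ?_ (add_le_add_left (sum_idealChange_potential_le H h0 hβ hpβ hσ hτ) _)
  rw [Finset.mul_sum, ← Finset.sum_add_distrib]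
  refine Finset.sum_le_sum fun v _ => ?_
  by_cases hS : S v
  · rw [ind_of_true hS]
    have hc := abs_potential_update_sub_le H hβ σ τ v
    set c := 1 + β * (H.maxDegree : ℝ)
    have hup : ∑ b, ∑ b', D v σ τ b b' *
        (potential H β (Function.update σ v b) (Function.update τ v b') - potential H β σ τ) ≤
        ∑ b, ∑ b', D v σ τ b b' * c :=
      Finset.sum_le_sum fun b _ => Finset.sum_le_sum fun b' _ =>
        mul_le_mul_of_nonneg_left (abs_le.mp (hc b b')).2 (hD0 v σ τ b b')
    have hlow : ∑ b, ∑ b', idealCoupling p (Blocked H σ v) (Blocked H τ v) b b' * (-c) ≤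
        idealChange H p (potential H β) σ τ v :=
      Finset.sum_le_sum fun b _ => Finset.sum_le_sum fun b' _ =>
        mul_le_mul_of_nonneg_left (abs_le.mp (hc b b')).1 (idealCoupling_nonneg h0 h1 _ _ b b')
    simp only [← Finset.sum_mul, hD1, sum_idealCoupling] at hup hlow
    linarith
  · rw [ind_of_false hS, mul_zero, add_zero, hD v σ τ hS]
    rfl

lemma update_eq_of_forall_ne {V Q : Type*} [DecidableEq V] {v : V} {σ τ : V → Q}
    (h : ∀ u, u ≠ v → σ u = τ u) : Function.update τ v (σ v) = σ := by
  funext u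
  by_cases e : u = v
  · subst e; simp
  · simp [e, h u e]

lemma sum_ite_update {V : Type*} [Fintype V] [DecidableEq V] (v : V)
    (p : (V → Bool) × (V → Bool)) (D : Bool → Bool → ℝ) (F : (V → Bool) × (V → Bool) → ℝ)
    [DecidablePred fun p' : (V → Bool) × (V → Bool) =>
      (∀ u, u ≠ v → p'.1 u = p.1 u) ∧ (∀ u, u ≠ v → p'.2 u = p.2 u)] :
    ∑ p' : (V → Bool) × (V → Bool),
      (if (∀ u, u ≠ v → p'.1 u = p.1 u) ∧ (∀ u, u ≠ v → p'.2 u = p.2 u)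
        then D (p'.1 v) (p'.2 v) else 0) * F p' =
      ∑ b, ∑ b', D b b' * F (Function.update p.1 v b, Function.update p.2 v b') := by
  simp only [ite_mul, zero_mul]
  rw [← Finset.sum_filter, ← Fintype.sum_prod_type' (f := fun b b' =>
    D b b' * F (Function.update p.1 v b, Function.update p.2 v b'))]
  refine Finset.sum_nbij' (fun p' => (p'.1 v, p'.2 v))
    (fun b => (Function.update p.1 v b.1, Function.update p.2 v b.2)) ?_ ?_ ?_ ?_ ?_
  · intros; simp
  · intro b _
    simp +contextual
  · intro p' hp'
    rw [Finset.mem_filter] at hp'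
    ext1
    · exact update_eq_of_forall_ne hp'.2.1
    · exact update_eq_of_forall_ne hp'.2.2
  · intros; simp
  · intro p' hp'
    rw [Finset.mem_filter] at hp'
    simp only [update_eq_of_forall_ne hp'.2.1, update_eq_of_forall_ne hp'.2.2, Prod.mk.eta]

lemma sum_pairKernel_mul {V : Type*} [Fintype V] [DecidableEq V]
    (D : V → (V → Bool) → (V → Bool) → Bool → Bool → ℝ) (p : (V → Bool) × (V → Bool))
    (F : (V → Bool) × (V → Bool) → ℝ) :
    ∑ p', pairKernel D p p' * F p' = (Fintype.card V : ℝ)⁻¹ * ∑ v, ∑ b, ∑ b',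
      D v p.1 p.2 b b' * F (Function.update p.1 v b, Function.update p.2 v b') := by
  classical
  unfold pairKernel
  simp only [mul_assoc, ← Finset.mul_sum]
  congr 1
  simp only [Finset.sum_mul]
  rw [Finset.sum_comm]
  refine Finset.sum_congr rfl fun v _ => ?_
  convert sum_ite_update v p (D v p.1 p.2) F

lemma pairKernel_nonneg {V : Type*} [Fintype V]
    {D : V → (V → Bool) → (V → Bool) → Bool → Bool → ℝ}
    (hD : ∀ v σ τ b b', 0 ≤ D v σ τ b b') (p p' : (V → Bool) × (V → Bool)) :
    0 ≤ pairKernel D p p' := by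
  unfold pairKernel
  refine mul_nonneg (by positivity) (Finset.sum_nonneg fun v _ => ?_)
  split_ifs
  · exact hD _ _ _ _ _
  · exact le_rfl

lemma isIndep_of_pairKernel_ne_zero {V : Type*} [Fintype V] [DecidableEq V] {H : SimpleGraph V}
    {D : V → (V → Bool) → (V → Bool) → Bool → Bool → ℝ}
    (hD1 : ∀ v σ τ b', D v σ τ true b' ≠ 0 → ¬ Blocked H σ v)
    (hD2 : ∀ v σ τ b, D v σ τ b true ≠ 0 → ¬ Blocked H τ v)
    {p p' : (V → Bool) × (V → Bool)} (h : pairKernel D p p' ≠ 0)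
    (hp1 : IsIndep H p.1) (hp2 : IsIndep H p.2) : IsIndep H p'.1 ∧ IsIndep H p'.2 := by
  unfold pairKernel at h
  obtain ⟨v, -, hv⟩ := Finset.exists_ne_zero_of_sum_ne_zero (right_ne_zero_of_mul h)
  split_ifs at hv with hc
  · rw [← update_eq_of_forall_ne hc.1, ← update_eq_of_forall_ne hc.2]
    refine ⟨hp1.update fun hb => ?_, hp2.update fun hb => ?_⟩
    · rw [hb] at hv
      exact hD1 _ _ _ _ hv
    · rw [hb] at hv
      exact hD2 _ _ _ _ hv
  · exact absurd rfl hv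

lemma chainDist_nonneg {S : Type*} [Fintype S] {P : S → S → ℝ} {init : S → ℝ}
    (hP : ∀ s s', 0 ≤ P s s') (hi : ∀ s, 0 ≤ init s) (t : ℕ) (s : S) :
    0 ≤ chainDist P init t s := by
  induction t generalizing s with
  | zero => exact hi s
  | succ t ih => exact Finset.sum_nonneg fun s' _ => mul_nonneg (ih s') (hP _ _)

lemma sum_chainDist_succ_mul {S : Type*} [Fintype S] (P : S → S → ℝ) (init F : S → ℝ) (t : ℕ) :
    ∑ s, chainDist P init (t + 1) s * F s =
      ∑ s, chainDist P init t s * ∑ s', P s s' * F s' := by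
  simp only [chainDist, Finset.sum_mul, Finset.mul_sum]
  rw [Finset.sum_comm]
  simp only [mul_assoc]

lemma sum_chainDist {S : Type*} [Fintype S] {P : S → S → ℝ} {init : S → ℝ}
    (hP : ∀ s, ∑ s', P s s' = 1) (hi : ∑ s, init s = 1) (t : ℕ) :
    ∑ s, chainDist P init t s = 1 := by
  induction t with
  | zero => exact hi
  | succ t ih =>
    have := sum_chainDist_succ_mul P init (fun _ => 1) t
    simpa [hP, ih] using this

lemma chainDist_support {S : Type*} [Fintype S] {P : S → S → ℝ} {init : S → ℝ} {R : S → Prop}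
    (hi : ∀ s, init s ≠ 0 → R s) (hP : ∀ s s', R s → P s s' ≠ 0 → R s') (t : ℕ) (s : S)
    (h : chainDist P init t s ≠ 0) : R s := by
  induction t generalizing s with
  | zero => exact hi s h
  | succ t ih =>
    obtain ⟨s', -, hs'⟩ := Finset.exists_ne_zero_of_sum_ne_zero h
    exact hP s' s (ih s' (left_ne_zero_of_mul hs')) (right_ne_zero_of_mul hs')

/-- A drift condition bounds the accumulated expected drift of a finite Markov chain. -/
lemma sum_chainDist_drift_le {S : Type*} [Fintype S] {P : S → S → ℝ} {init : S → ℝ}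
    {R : S → Prop} (hP0 : ∀ s s', 0 ≤ P s s') (hP1 : ∀ s, ∑ s', P s s' = 1)
    (hi0 : ∀ s, 0 ≤ init s) (hi1 : ∑ s, init s = 1)
    (hi : ∀ s, init s ≠ 0 → R s) (hP : ∀ s s', R s → P s s' ≠ 0 → R s')
    {F d : S → ℝ} {C : ℝ} (hF : ∀ s, 0 ≤ F s)
    (hdrift : ∀ s, R s → ∑ s', P s s' * F s' ≤ F s - d s + C) (T : ℕ) :
    ∑ t ∈ Finset.range T, ∑ s, chainDist P init t s * d s ≤ ∑ s, init s * F s + T * C := by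
  have hstep : ∀ t, ∑ s, chainDist P init t s * d s ≤
      ∑ s, chainDist P init t s * F s - ∑ s, chainDist P init (t + 1) s * F s + C := by
    intro t
    have h1 : ∑ s, chainDist P init (t + 1) s * F s ≤
        ∑ s, chainDist P init t s * (F s - d s + C) := by
      rw [sum_chainDist_succ_mul]
      refine Finset.sum_le_sum fun s _ => ?_
      by_cases h : chainDist P init t s = 0
      · simp [h]
      · exact mul_le_mul_of_nonneg_left (hdrift s (chainDist_support hi hP t s h))
          (chainDist_nonneg hP0 hi0 t s)
    simp only [mul_add, mul_sub, Finset.sum_add_distrib, Finset.sum_sub_distrib,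
      ← Finset.sum_mul, sum_chainDist hP1 hi1 t, one_mul] at h1
    linarith
  have htel : ∑ t ∈ Finset.range T, ∑ s, chainDist P init t s * d s ≤
      ∑ s, init s * F s - ∑ s, chainDist P init T s * F s + T * C := by
    induction T with
    | zero => simp [chainDist]
    | succ T ih =>
      rw [Finset.sum_range_succ]
      have := hstep T
      push_cast
      linarith
  have : 0 ≤ ∑ s, chainDist P init T s * F s :=
    Finset.sum_nonneg fun s _ => mul_nonneg (chainDist_nonneg hP0 hi0 T s) (hF s)
  linarith

lemma margHC_true {V : Type*} [Fintype V] (G : SimpleGraph V) [DecidableRel G.Adj]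
    (lam : ℝ) (v : V) (τ : V → Bool) :
    margHC G lam v τ true = lam / (1 + lam) * ind (¬ Blocked G τ v) := by
  by_cases h : Blocked G τ v
  · have h' : ¬ ∀ u, G.Adj v u → τ u = false := by
      obtain ⟨w, hw, hb⟩ := h
      intro hall
      simp [hall w hw] at hb
    simp [margHC, h', ind, h]
  · have h' : ∀ u, G.Adj v u → τ u = false := fun u hu => by
      by_contra hb
      exact h ⟨u, hu, by simpa using hb⟩
    have h'' : ∀ u ∈ G.neighborFinset v, τ u = false := fun u hu => h' u (by simpa using hu)
    rw [ind_of_true h, mul_one]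
    unfold margHC
    rw [if_pos h'']
    rfl

lemma margHC_false {V : Type*} [Fintype V] (G : SimpleGraph V) [DecidableRel G.Adj]
    {lam : ℝ} (hlam : 0 < lam) (v : V) (τ : V → Bool) :
    margHC G lam v τ false = 1 - margHC G lam v τ true := by
  unfold margHC
  split_ifs <;> simp at *
  field_simp
  ring

lemma margHC_nonneg {V : Type*} [Fintype V] (G : SimpleGraph V) [DecidableRel G.Adj]
    {lam : ℝ} (hlam : 0 < lam) (v : V) (τ : V → Bool) (b : Bool) : 0 ≤ margHC G lam v τ b := by
  unfold margHC
  split_ifs <;> positivity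

/-- For Bernoulli marginals that are either zero or `p`, the optimal coupling is unique. -/
lemma IsOptimalCoupling.eq_idealCoupling {μ ν : Bool → ℝ} {D : Bool → Bool → ℝ}
    (h : IsOptimalCoupling μ ν D) {p : ℝ} (h0 : 0 ≤ p) (h1 : p ≤ 1) {P Q : Prop}
    (hμ : μ true = p * ind (¬ P)) (hμ' : μ false = 1 - μ true)
    (hν : ν true = p * ind (¬ Q)) (hν' : ν false = 1 - ν true) :
    D = idealCoupling p P Q := by
  obtain ⟨⟨hnn, hrow, hcol⟩, hopt⟩ := h
  have n1 := hnn true true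
  have n2 := hnn true false
  have n3 := hnn false true
  have n4 := hnn false false
  have r1 := hrow true
  have r2 := hrow false
  have c1 := hcol true
  have c2 := hcol false
  have hideal := hopt (idealCoupling p P Q) ⟨idealCoupling_nonneg h0 h1 P Q, by
      intro c
      cases c <;> by_cases hP : P <;> by_cases hQ : Q <;>
        simp [idealCoupling, ind, hP, hQ, hμ, hμ'], by
      intro c
      cases c <;> by_cases hP : P <;> by_cases hQ : Q <;>
        simp [idealCoupling, ind, hP, hQ, hν, hν']⟩
  simp only [Fintype.sum_bool, hμ', hν', hμ, hν] at r1 r2 c1 c2 hideal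
  funext b b'
  cases b <;> cases b' <;> by_cases hP : P <;> by_cases hQ : Q <;>
    simp [idealCoupling, ind, hP, hQ] at r1 r2 c1 c2 hideal ⊢ <;> linarith

lemma sum_ind_inS_le {V : Type*} [Fintype V] [DecidableEq V] (G G' : SimpleGraph V)
    [Fintype G.edgeSet] [Fintype G'.edgeSet] :
    ∑ v, ind (inS G G' v) ≤ 2 * ((symmDiff G.edgeFinset G'.edgeFinset).card : ℝ) := by
  classical
  rw [sum_ind_eq_card]
  have hsub : (univ.filter fun v => inS G G' v) ⊆
      (symmDiff G.edgeFinset G'.edgeFinset).biUnion Sym2.toFinset := by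
    intro v hv
    obtain ⟨u, hu⟩ := (Finset.mem_filter.mp hv).2
    rw [Finset.mem_biUnion]
    exact ⟨s(v, u), by simpa [Finset.mem_symmDiff] using hu, by simp⟩
  have hcard : ((symmDiff G.edgeFinset G'.edgeFinset).biUnion Sym2.toFinset).card ≤
      (symmDiff G.edgeFinset G'.edgeFinset).card * 2 := by
    refine Finset.card_biUnion_le_card_mul _ _ _ fun e _ => ?_
    induction e using Sym2.ind with
    | _ x y =>
      have : (s(x, y) : Sym2 V).toFinset ⊆ {x, y} := by
        intro z hz
        simpa using hz
      exact (Finset.card_le_card this).trans Finset.card_le_two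
  have := (Finset.card_le_card hsub).trans hcard
  rw [mul_comm] at this
  exact_mod_cast this

lemma sum_indSnbr_le {V : Type*} [Fintype V] (G G' : SimpleGraph V)
    [DecidableRel G.Adj] (p : (V → Bool) × (V → Bool)) :
    ∑ v, indSnbr G G' p v ≤
      ∑ v, ind (inS G G' v) + (1 + (G.maxDegree : ℝ)) * disagree p.1 p.2 := by
  have h1 : ∀ v, indSnbr G G' p v ≤ ind (inS G G' v) +
      (ind (p.1 v ≠ p.2 v) + ∑ u, ind (G.Adj v u) * ind (p.1 u ≠ p.2 u)) := by
    intro v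
    have hsum : 0 ≤ ∑ u, ind (G.Adj v u) * ind (p.1 u ≠ p.2 u) :=
      Finset.sum_nonneg fun u _ => mul_nonneg (ind_nonneg _) (ind_nonneg _)
    have hS := ind_nonneg (inS G G' v)
    have hv := ind_nonneg (p.1 v ≠ p.2 v)
    unfold indSnbr
    split_ifs with h
    · rcases h with h | ⟨u, rfl | hu, hne⟩
      · rw [ind_of_true h]
        linarith
      · rw [ind_of_true hne]
        linarith
      · have := Finset.single_le_sum (f := fun u => ind (G.Adj v u) * ind (p.1 u ≠ p.2 u))
          (fun u _ => mul_nonneg (ind_nonneg _) (ind_nonneg _)) (Finset.mem_univ u)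
        simp only [ind_of_true hu, ind_of_true hne] at this
        linarith
    · linarith
  refine (Finset.sum_le_sum fun v _ => h1 v).trans ?_
  have h2 : ∑ v, ∑ u, ind (G.Adj v u) * ind (p.1 u ≠ p.2 u) ≤
      G.maxDegree * disagree p.1 p.2 := by
    rw [Finset.sum_comm]
    unfold disagree
    rw [Finset.mul_sum]
    refine Finset.sum_le_sum fun v _ => ?_
    rw [← Finset.sum_mul]
    exact mul_le_mul_of_nonneg_right (sum_ind_adj_le G v) (ind_nonneg _)
  simp only [Finset.sum_add_distrib]
  unfold disagree at *
  linarith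

lemma le_of_isIndep_imp {V : Type*} {H K : SimpleGraph V}
    (h : ∀ σ : V → Bool, IsIndep K σ → IsIndep H σ) : H ≤ K := by
  classical
  intro u v huv
  by_contra hK
  refine h (fun w => decide (w = u ∨ w = v)) ?_ u v huv (by simp)
  rintro x y hxy ⟨hx, hy⟩
  simp only [decide_eq_true_eq] at hx hy
  rcases hx with rfl | rfl <;> rcases hy with rfl | rfl
  · exact hxy.ne rfl
  · exact hK hxy
  · exact hK hxy.symm
  · exact hxy.ne rfl

lemma localCoupling_nonneg {V : Type*} [Fintype V]
    {G G' : SimpleGraph V} [DecidableRel G.Adj] [DecidableRel G'.Adj] {lam : ℝ} (hlam : 0 < lam)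
    {D : V → (V → Bool) → (V → Bool) → Bool → Bool → ℝ}
    (hDS : ∀ (v : V) (σ τ : V → Bool), inS G G' v →
      ∀ b b', D v σ τ b b' = margHC G lam v σ b * margHC G' lam v τ b')
    (hDopt : ∀ (v : V) (σ τ : V → Bool), ¬ inS G G' v →
      IsOptimalCoupling (margHC G lam v σ) (margHC G lam v τ) (D v σ τ))
    (v : V) (σ τ : V → Bool) (b b' : Bool) : 0 ≤ D v σ τ b b' := by
  by_cases hv : inS G G' v
  · rw [hDS v σ τ hv]
    exact mul_nonneg (margHC_nonneg G hlam v σ b) (margHC_nonneg G' hlam v τ b')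
  · exact (hDopt v σ τ hv).1.1 b b'

lemma sum_localCoupling {V : Type*} [Fintype V]
    {G G' : SimpleGraph V} [DecidableRel G.Adj] [DecidableRel G'.Adj] {lam : ℝ} (hlam : 0 < lam)
    {D : V → (V → Bool) → (V → Bool) → Bool → Bool → ℝ}
    (hDS : ∀ (v : V) (σ τ : V → Bool), inS G G' v →
      ∀ b b', D v σ τ b b' = margHC G lam v σ b * margHC G' lam v τ b')
    (hDopt : ∀ (v : V) (σ τ : V → Bool), ¬ inS G G' v →
      IsOptimalCoupling (margHC G lam v σ) (margHC G lam v τ) (D v σ τ))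
    (v : V) (σ τ : V → Bool) : ∑ b, ∑ b', D v σ τ b b' = 1 := by
  by_cases hv : inS G G' v
  · simp only [hDS v σ τ hv, Fintype.sum_bool, margHC_false G hlam, margHC_false G' hlam]
    ring
  · simp only [(hDopt v σ τ hv).1.2.1, Fintype.sum_bool, margHC_false G hlam]
    ring

lemma sum_pairKernel {V : Type*} [Fintype V] [DecidableEq V] [Nonempty V]
    {D : V → (V → Bool) → (V → Bool) → Bool → Bool → ℝ}
    (hD : ∀ v σ τ, ∑ b, ∑ b', D v σ τ b b' = 1) (p : (V → Bool) × (V → Bool)) :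
    ∑ p', pairKernel D p p' = 1 := by
  have := sum_pairKernel_mul D p (fun _ => 1)
  simp only [mul_one, hD, Finset.sum_const, Finset.card_univ, nsmul_eq_mul] at this
  rw [this, inv_mul_cancel₀ (by exact_mod_cast Fintype.card_ne_zero)]

lemma initDelta_nonneg {S : Type*} [DecidableEq S] (s₀ s : S) : 0 ≤ initDelta s₀ s := by
  unfold initDelta
  split_ifs <;> norm_num

lemma sum_initDelta {S : Type*} [Fintype S] [DecidableEq S] (s₀ : S) :
    ∑ s, initDelta s₀ s = 1 := by
  simp [initDelta]

/-- The accumulated expected number of disagreements of the coupled hardcore chains, when `H` is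
a common subgraph of `G` and `G'` that lies in the regime `λ (Δ - 2) ≤ 2 - δ` and agrees with `G`
off the endpoints of modified edges. -/
lemma sum_chainDist_disagree_le {V : Type*} [Fintype V] [DecidableEq V] [Nonempty V]
    (G G' H : SimpleGraph V) [DecidableRel G.Adj] [DecidableRel G'.Adj] [DecidableRel H.Adj]
    {δ lam : ℝ} (hδ : 0 < δ) (hlam : 0 < lam) (hΔ : 3 ≤ H.maxDegree)
    (hreg : lam * ((H.maxDegree : ℝ) - 2) ≤ 2 - δ) (hG : H ≤ G) (hG' : H ≤ G')
    (hH : ∀ v, ¬ inS G G' v → ∀ u, G.Adj v u ↔ H.Adj v u)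
    {D : V → (V → Bool) → (V → Bool) → Bool → Bool → ℝ}
    (hDS : ∀ (v : V) (σ τ : V → Bool), inS G G' v →
      ∀ b b', D v σ τ b b' = margHC G lam v σ b * margHC G' lam v τ b')
    (hDopt : ∀ (v : V) (σ τ : V → Bool), ¬ inS G G' v →
      IsOptimalCoupling (margHC G lam v σ) (margHC G lam v τ) (D v σ τ)) (T : ℕ) :
    δ * ∑ t ∈ Finset.range T, ∑ p : (V → Bool) × (V → Bool),
        chainDist (pairKernel D)
          (initDelta (((fun _ => false) : V → Bool), ((fun _ => false) : V → Bool))) t p *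
        disagree p.1 p.2 ≤ 48 * T * ∑ v, ind (inS G G' v) := by
  set q := lam / (1 + lam) with hq
  have h0 : 0 ≤ q := by positivity
  have h1 : q ≤ 1 := by rw [hq, div_le_one (by linarith)]; linarith
  have hideal : ∀ v σ τ, ¬ inS G G' v →
      D v σ τ = idealCoupling q (Blocked H σ v) (Blocked H τ v) := by
    intro v σ τ hv
    have hb : ∀ σ, Blocked H σ v ↔ Blocked G σ v := fun σ =>
      exists_congr fun u => by rw [hH v hv u]
    rw [hb, hb]
    exact (hDopt v σ τ hv).eq_idealCoupling h0 h1 (margHC_true G lam v σ)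
      (margHC_false G hlam v σ) (margHC_true G lam v τ) (margHC_false G hlam v τ)
  have hD0 := localCoupling_nonneg hlam hDS hDopt
  have hD1 := sum_localCoupling hlam hDS hDopt
  have hblk1 : ∀ v σ τ b', D v σ τ true b' ≠ 0 → ¬ Blocked H σ v := by
    intro v σ τ b' hne hb
    apply hne
    by_cases hv : inS G G' v
    · simp [hDS v σ τ hv, margHC_true, ind, hb.mono hG]
    · rw [hideal v σ τ hv]
      cases b' <;> simp [idealCoupling, ind, hb]
  have hblk2 : ∀ v σ τ b, D v σ τ b true ≠ 0 → ¬ Blocked H τ v := by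
    intro v σ τ b hne hb
    apply hne
    by_cases hv : inS G G' v
    · simp [hDS v σ τ hv, margHC_true, ind, hb.mono hG']
    · rw [hideal v σ τ hv]
      cases b <;> simp [idealCoupling, ind, hb]
  have hn : (0 : ℝ) < Fintype.card V := by exact_mod_cast Fintype.card_pos
  have hΔr : (3 : ℝ) ≤ H.maxDegree := by exact_mod_cast hΔ
  have hlam2 : lam ≤ 2 := by nlinarith
  have hβ : 0 ≤ lam / 2 := by positivity
  have hqβ : lam / 2 * (1 - q) = q / 2 := by rw [hq]; field_simp; ring
  have hrate : δ / 6 ≤ 1 - q / 2 * H.maxDegree := by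
    have : 1 - q / 2 * H.maxDegree = (2 - lam * ((H.maxDegree : ℝ) - 2)) / (2 * (1 + lam)) := by
      rw [hq]; field_simp; ring
    rw [this, div_le_div_iff₀ (by norm_num) (by positivity)]
    nlinarith
  have hcost : 1 + lam / 2 * H.maxDegree ≤ 4 := by nlinarith
  set s := ∑ v, ind (inS G G' v) with hs
  have hs0 : 0 ≤ s := Finset.sum_nonneg fun _ _ => ind_nonneg _
  have key := sum_chainDist_drift_le (P := pairKernel D)
    (init := initDelta (((fun _ => false) : V → Bool), ((fun _ => false) : V → Bool)))
    (R := fun p => IsIndep H p.1 ∧ IsIndep H p.2)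
    (pairKernel_nonneg hD0) (sum_pairKernel hD1)
    (initDelta_nonneg _) (sum_initDelta _)
    (fun p hp => by
      have : p = (((fun _ => false) : V → Bool), ((fun _ => false) : V → Bool)) := by
        by_contra h
        exact hp (by simp [initDelta, h])
      subst this
      constructor <;> simp [IsIndep])
    (fun p p' hp h => isIndep_of_pairKernel_ne_zero hblk1 hblk2 h hp.1 hp.2)
    (F := fun p => potential H (lam / 2) p.1 p.2)
    (d := fun p => (Fintype.card V : ℝ)⁻¹ * (δ / 6) * disagree p.1 p.2)
    (C := (Fintype.card V : ℝ)⁻¹ * (8 * s))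
    (fun p => potential_nonneg H hβ p.1 p.2)
    (by
      rintro ⟨σ, τ⟩ ⟨hσ, hτ⟩
      have hch := sum_change_potential_le H h0 h1 hβ hqβ (inS G G') D hD0 hD1 hideal hσ hτ
      simp only [mul_sub, Finset.sum_sub_distrib, ← Finset.sum_mul, hD1, one_mul,
        Finset.sum_const, Finset.card_univ, nsmul_eq_mul] at hch
      rw [sum_pairKernel_mul]
      have hdis := disagree_nonneg σ τ
      have hr := mul_le_mul_of_nonneg_right hrate hdis
      have hc := mul_le_mul_of_nonneg_right hcost hs0
      have hle : ∑ v, ∑ b, ∑ b', D v σ τ b b' *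
          potential H (lam / 2) (Function.update σ v b) (Function.update τ v b') ≤
          Fintype.card V * potential H (lam / 2) σ τ - δ / 6 * disagree σ τ + 8 * s := by
        linarith
      refine (mul_le_mul_of_nonneg_left hle (inv_nonneg.mpr hn.le)).trans (le_of_eq ?_)
      field_simp) T
  have hinit : ∑ p : (V → Bool) × (V → Bool),
      initDelta (((fun _ => false) : V → Bool), ((fun _ => false) : V → Bool)) p *
        potential H (lam / 2) p.1 p.2 = 0 := by
    simp [initDelta, potential_self]
  rw [hinit, zero_add] at key
  simp only [mul_left_comm _ ((Fintype.card V : ℝ)⁻¹ * (δ / 6)), ← Finset.mul_sum] at key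
  rw [mul_left_comm, mul_assoc, mul_le_mul_iff_of_pos_left (inv_pos.mpr hn)] at key
  linarith

/-- There is an absolute constant `c` such that for all hardcore instances
`I = (V,E,λ)` and `I' = (V,E',λ)` on the same vertex set with `|E ⊕ E'| ≤ L`,
`Δ = max{Δ_G, Δ_{G'}} ≥ 3`, and either (i) `λ ≤ (2−δ)/(Δ_G−2)` and `Ω_{I'} ⊆ Ω_I` or
(ii) `λ ≤ (2−δ)/(Δ_{G'}−2)` and `Ω_I ⊆ Ω_{I'}`, the one-step local coupling for edge update
run for `T` steps from `X_0 = Y_0 = 0^V` satisfies `E[R_gra] ≤ c·Δ²·T·L/(δ·n)`.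
The expectation of `R_gra = Σ_{t=1}^T 1{v_t ∈ S ∪ Γ_G⁺(D_{t−1})}` is written in closed form
as in the paper. -/
theorem hardcore_expected_R_gra_bound :
    ∃ c : ℝ, 0 < c ∧
      ∀ (V : Type) [Fintype V] [DecidableEq V] [Nonempty V],
      ∀ (G G' : SimpleGraph V) [DecidableRel G.Adj] [DecidableRel G'.Adj]
        [Fintype G.edgeSet] [Fintype G'.edgeSet],
      ∀ (δ lam L : ℝ) (T : ℕ),
        0 < δ → δ ≤ 1 → 0 < lam →
        3 ≤ max G.maxDegree G'.maxDegree →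
        ((symmDiff G.edgeFinset G'.edgeFinset).card : ℝ) ≤ L →
        ((lam ≤ (2 - δ) / ((G.maxDegree : ℝ) - 2) ∧
            (∀ σ : V → Bool, IsIndep G' σ → IsIndep G σ)) ∨
          (lam ≤ (2 - δ) / ((G'.maxDegree : ℝ) - 2) ∧
            (∀ σ : V → Bool, IsIndep G σ → IsIndep G' σ))) →
        ∀ Dloc : V → (V → Bool) → (V → Bool) → Bool → Bool → ℝ,
        (∀ (v : V) (σ τ : V → Bool), inS G G' v →
          ∀ b b', Dloc v σ τ b b' = margHC G lam v σ b * margHC G' lam v τ b') →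
        (∀ (v : V) (σ τ : V → Bool), ¬ inS G G' v →
          IsOptimalCoupling (margHC G lam v σ) (margHC G lam v τ) (Dloc v σ τ)) →
        ∑ t ∈ Finset.range T,
            ∑ p : (V → Bool) × (V → Bool),
              chainDist (pairKernel Dloc)
                (initDelta (((fun _ => false) : V → Bool),
                  ((fun _ => false) : V → Bool))) t p *
              ((Fintype.card V : ℝ)⁻¹ * ∑ v : V, indSnbr G G' p v)
          ≤ c * (max G.maxDegree G'.maxDegree : ℝ) ^ 2 * T * L /
              (δ * (Fintype.card V : ℝ)) := by
  refine ⟨98, by norm_num, ?_⟩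
  intro V _ _ _ G G' _ _ _ _ δ lam L T hδ hδ1 hlam hΔ hL hcase D hDS hDopt
  have hgap : ∀ d : ℕ, lam ≤ (2 - δ) / ((d : ℝ) - 2) →
      3 ≤ d ∧ lam * ((d : ℝ) - 2) ≤ 2 - δ := by
    intro d hd
    have hpos : 0 < (d : ℝ) - 2 := by
      by_contra hneg
      have := div_nonpos_of_nonneg_of_nonpos (by linarith : (0 : ℝ) ≤ 2 - δ) (not_lt.mp hneg)
      linarith
    refine ⟨?_, (le_div_iff₀ hpos).mp hd⟩
    have : (2 : ℝ) < d := by linarith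
    exact_mod_cast this
  have hdis : δ * ∑ t ∈ Finset.range T, ∑ p : (V → Bool) × (V → Bool),
      chainDist (pairKernel D)
        (initDelta (((fun _ => false) : V → Bool), ((fun _ => false) : V → Bool))) t p *
      disagree p.1 p.2 ≤ 48 * T * ∑ v, ind (inS G G' v) := by
    rcases hcase with ⟨hlamG, hind⟩ | ⟨hlamG, hind⟩
    · obtain ⟨h3, hreg⟩ := hgap _ hlamG
      exact sum_chainDist_disagree_le G G' G hδ hlam h3 hreg le_rfl (le_of_isIndep_imp hind)
        (fun _ _ _ => Iff.rfl) hDS hDopt T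
    · obtain ⟨h3, hreg⟩ := hgap _ hlamG
      refine sum_chainDist_disagree_le G G' G' hδ hlam h3 hreg (le_of_isIndep_imp hind) le_rfl
        (fun v hv u => ?_) hDS hDopt T
      have : ¬ ((G.Adj v u ∧ ¬ G'.Adj v u) ∨ (G'.Adj v u ∧ ¬ G.Adj v u)) := fun h => hv ⟨u, h⟩
      tauto
  have hD0 := localCoupling_nonneg hlam hDS hDopt
  have hD1 := sum_localCoupling hlam hDS hDopt
  have hn : (0 : ℝ) < Fintype.card V := by exact_mod_cast Fintype.card_pos
  have hS := sum_ind_inS_le G G'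
  set s := ∑ v, ind (inS G G' v)
  set M : ℝ := max (G.maxDegree : ℝ) (G'.maxDegree : ℝ) with hM
  have hMG : (G.maxDegree : ℝ) ≤ M := le_max_left _ _
  have hM3 : 3 ≤ M := by
    rw [hM]
    exact_mod_cast hΔ
  set E := ∑ t ∈ Finset.range T, ∑ p : (V → Bool) × (V → Bool),
    chainDist (pairKernel D)
      (initDelta (((fun _ => false) : V → Bool), ((fun _ => false) : V → Bool))) t p *
    disagree p.1 p.2 with hE
  have hdist := chainDist_nonneg (pairKernel_nonneg hD0)
    (initDelta_nonneg (((fun _ => false) : V → Bool), ((fun _ => false) : V → Bool)))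
  have hE0 : 0 ≤ E := Finset.sum_nonneg fun t _ => Finset.sum_nonneg fun p _ =>
    mul_nonneg (hdist t p) (disagree_nonneg _ _)
  have hbound : ∑ t ∈ Finset.range T, ∑ p : (V → Bool) × (V → Bool),
      chainDist (pairKernel D)
        (initDelta (((fun _ => false) : V → Bool), ((fun _ => false) : V → Bool))) t p *
      ((Fintype.card V : ℝ)⁻¹ * ∑ v : V, indSnbr G G' p v) ≤
      (Fintype.card V : ℝ)⁻¹ * (T * s + (1 + M) * E) := by
    calc _ ≤ ∑ t ∈ Finset.range T, ∑ p : (V → Bool) × (V → Bool),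
          (Fintype.card V : ℝ)⁻¹ * (chainDist (pairKernel D)
            (initDelta (((fun _ => false) : V → Bool), ((fun _ => false) : V → Bool))) t p * s +
          (1 + M) * (chainDist (pairKernel D)
            (initDelta (((fun _ => false) : V → Bool), ((fun _ => false) : V → Bool))) t p *
              disagree p.1 p.2)) := by
          refine Finset.sum_le_sum fun t _ => Finset.sum_le_sum fun p _ => ?_
          have hle : ∑ v, indSnbr G G' p v ≤ s + (1 + M) * disagree p.1 p.2 :=
            (sum_indSnbr_le G G' p).trans (add_le_add_right (mul_le_mul_of_nonneg_right
              (by linarith) (disagree_nonneg _ _)) _)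
          have := mul_le_mul_of_nonneg_left hle
            (mul_nonneg (inv_nonneg.mpr hn.le) (hdist t p))
          linarith
      _ = _ := by
          simp only [← Finset.mul_sum, Finset.sum_add_distrib, ← Finset.sum_mul]
          simp only [sum_chainDist (sum_pairKernel hD1) (sum_initDelta _), Finset.sum_const,
            Finset.card_range, nsmul_eq_mul, mul_one]
          rw [hE]
  refine hbound.trans ?_
  rw [inv_mul_eq_div, div_le_div_iff₀ hn (by positivity)]
  have hT : (0 : ℝ) ≤ T := T.cast_nonneg
  have hs2 : s ≤ 2 * L := by linarith
  have hL0 : 0 ≤ L := le_trans (Nat.cast_nonneg _) hL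
  have hTs : T * s ≤ T * (2 * L) := mul_le_mul_of_nonneg_left hs2 hT
  have hTL : 0 ≤ T * L := mul_nonneg hT hL0
  have hM2 : 1 + M ≤ M ^ 2 := by nlinarith
  have hdE : δ * E ≤ 96 * (T * L) := by linarith
  have h1 : (1 + M) * (δ * E) ≤ M ^ 2 * (96 * (T * L)) :=
    mul_le_mul hM2 hdE (by positivity) (by positivity)
  have h2 : δ * (T * s) ≤ M ^ 2 * (2 * (T * L)) := by
    have h3 : δ * (T * s) ≤ δ * (2 * (T * L)) :=
      mul_le_mul_of_nonneg_left (by linarith) hδ.le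
    have h4 : δ * (2 * (T * L)) ≤ M ^ 2 * (2 * (T * L)) :=
      mul_le_mul_of_nonneg_right (by nlinarith) (by linarith)
    exact h3.trans h4
  have h5 : (T * s + (1 + M) * E) * δ ≤ 98 * M ^ 2 * T * L := by linarith
  have := mul_le_mul_of_nonneg_right h5 hn.le
  linarith
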